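/- Let T be a finitely generated torsion class in rep Q and let P be the direct sum of one representative of each isomorphism class of indecomposable objects of T that are Ext-projective but not split projective. Then a(T) = {X ∈ T : Hom(P, X) = 0} = {X ∈ T : Hom(P, X) = 0 and Ext^1(P, X) = 0}. -/

import Mathlib

open CategoryTheory CategoryTheory.Limits ZeroObject

attribute [local instance] CategoryTheory.Abelian.hasFiniteBiproducts

noncomputable section

namespace NCPaper

/-- A finite quiver without oriented cycles. -/
structure FinQuiver : Type 1 where
  V : Type
  [quiver : Quiver.{0} V]
  [fintypeV : Fintype V]
  [fintypeArr : ∀ a b : V, Fintype (a ⟶ b)]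
  acyclic : ∀ (v : V) (p : Quiver.Path v v), p = Quiver.Path.nil

attribute [instance] FinQuiver.quiver FinQuiver.fintypeV FinQuiver.fintypeArr

variable (k : Type) [Field k] (Q : FinQuiver)

/-- The ambient abelian category of all `k`-linear representations of `Q`;
finite-dimensional representations are singled out by the predicate `FinDim`. -/
abbrev RepC : Type 1 := Paths Q.V ⥤ ModuleCat.{0} k

variable {k Q}

/-- `M` is a finite-dimensional representation, i.e. an object of `rep Q`. -/
def FinDim (M : RepC k Q) : Prop :=
  ∀ v : Q.V, FiniteDimensional k (M.obj ((Paths.of Q.V).obj v))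

section Cat

variable {C : Type*} [Category C] [Abelian C]

/-- `X` is a direct summand of `A`. -/
def IsSummand (X A : C) : Prop := ∃ (i : X ⟶ A) (r : A ⟶ X), i ≫ r = 𝟙 X

/-- The additive closure of a set of objects: direct summands of finite direct sums. -/
def addSet (S : Set C) : Set C :=
  { X | ∃ (n : ℕ) (f : Fin n → C), (∀ i, f i ∈ S) ∧ IsSummand X (⨁ f) }

/-- `Gen S`: all quotients of objects of the additive closure of `S`. -/
def gen (S : Set C) : Set C := { X | ∃ A ∈ addSet S, ∃ p : A ⟶ X, Epi p }

/-- All morphisms from `A` to `B` vanish. -/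
def HomZero (A B : C) : Prop := ∀ f : A ⟶ B, f = 0

/-- `Ext¹(A, B) = 0`, expressed by the splitting of all short exact sequences
`0 ⟶ B ⟶ E ⟶ A ⟶ 0`. -/
def Ext1Zero (A B : C) : Prop :=
  ∀ (E : C) (i : B ⟶ E) (p : E ⟶ A) (w : i ≫ p = 0),
    (ShortComplex.mk i p w).ShortExact → ∃ r : E ⟶ B, i ≫ r = 𝟙 B

/-- An indecomposable object. -/
def Indec (X : C) : Prop :=
  ¬ IsZero X ∧ ∀ (A B : C), (X ≅ A ⊞ B) → IsZero A ∨ IsZero B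

/-- A torsion class: a full subcategory (identified with its set of objects) closed under
direct sums, direct summands, quotients and extensions. -/
structure IsTorsionClass (T : Set C) : Prop where
  zero_mem : (0 : C) ∈ T
  sum_mem : ∀ X ∈ T, ∀ Y ∈ T, (X ⊞ Y : C) ∈ T
  summand_mem : ∀ X ∈ T, ∀ Y : C, IsSummand Y X → Y ∈ T
  quot_mem : ∀ X ∈ T, ∀ (Y : C) (p : X ⟶ Y), Epi p → Y ∈ T
  ext_mem : ∀ S : ShortComplex C, S.ShortExact → S.X₁ ∈ T → S.X₃ ∈ T → S.X₂ ∈ T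

/-- A wide subcategory: a full subcategory (closed under direct sums and summands)
which is exact abelian (closed under kernels and cokernels) and closed under extensions. -/
structure IsWide (A : Set C) : Prop where
  zero_mem : (0 : C) ∈ A
  sum_mem : ∀ X ∈ A, ∀ Y ∈ A, (X ⊞ Y : C) ∈ A
  summand_mem : ∀ X ∈ A, ∀ Y : C, IsSummand Y X → Y ∈ A
  ker_mem : ∀ X ∈ A, ∀ Y ∈ A, ∀ f : X ⟶ Y, (kernel f : C) ∈ A
  coker_mem : ∀ X ∈ A, ∀ Y ∈ A, ∀ f : X ⟶ Y, (cokernel f : C) ∈ A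
  ext_mem : ∀ S : ShortComplex C, S.ShortExact → S.X₁ ∈ A → S.X₃ ∈ A → S.X₂ ∈ A

/-- `P` is split projective in the subcategory `T`: every epimorphism onto `P`
from an object of `T` splits. -/
def SplitProjIn (T : Set C) (P : C) : Prop :=
  P ∈ T ∧ ∀ X ∈ T, ∀ p : X ⟶ P, Epi p → ∃ s : P ⟶ X, s ≫ p = 𝟙 P

/-- `P` is Ext-projective in the subcategory `T`. -/
def ExtProjIn (T : Set C) (P : C) : Prop := P ∈ T ∧ ∀ X ∈ T, Ext1Zero P X

/-- The subcategory `a(T)` associated to a torsion class `T`. -/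
def aSet (T : Set C) : Set C :=
  { B | B ∈ T ∧ ∀ Y ∈ T, ∀ g : Y ⟶ B, (kernel g : C) ∈ T }

/-- A subcategory is finitely generated if it is generated by a single object of it. -/
def IsFinGen (T : Set C) : Prop := ∃ U ∈ T, T ⊆ gen {U}

/-- `U` is a generator of the subcategory `T`. -/
def IsGenerator (T : Set C) (U : C) : Prop := U ∈ T ∧ T ⊆ gen {U}

/-- `X` is a subquotient of `M`. -/
def IsSubquotient (X M : C) : Prop := ∃ (N : C) (i : N ⟶ M) (p : N ⟶ X), Mono i ∧ Epi p

/-- The support of `M` is contained in the support of `C0`: every simple subquotient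
(composition factor) of `M` is a composition factor of `C0`. -/
def SuppLE (M C0 : C) : Prop := ∀ S : C, Simple S → IsSubquotient S M → IsSubquotient S C0

/-- A partial tilting object of a hereditary category. -/
def IsPartialTilting (T : C) : Prop := Ext1Zero T T

/-- `T` is a tilting object of the full subcategory `A`: it is self-orthogonal and every
(split) projective object of `A` admits a coresolution `0 ⟶ P ⟶ T' ⟶ T'' ⟶ 0` with
`T', T'' ∈ add T`. For `A` the subcategory of representations supported on `supp T`,
this says exactly that `T` is a tilting `kQ/ann T`-module. -/
def TiltingIn (A : Set C) (T : C) : Prop :=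
  T ∈ A ∧ Ext1Zero T T ∧
    ∀ P : C, SplitProjIn A P →
      ∃ (T' T'' : C) (_ : T' ∈ addSet {T}) (_ : T'' ∈ addSet {T})
        (i : P ⟶ T') (p : T' ⟶ T'') (w : i ≫ p = 0),
        (ShortComplex.mk i p w).ShortExact


/-- `U` is the direct sum of one representative of each isomorphism class of
indecomposable Ext-projective objects of `T`. -/
def IsExtProjSum (T : Set C) (U : C) : Prop :=
  ∃ (n : ℕ) (f : Fin n → C),
    (∀ i, Indec (f i) ∧ ExtProjIn T (f i)) ∧
    (∀ i j, Nonempty (f i ≅ f j) → i = j) ∧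
    (∀ P : C, Indec P → ExtProjIn T P → ∃ i, Nonempty (P ≅ f i)) ∧
    Nonempty (U ≅ ⨁ f)

/-- A basic object: a direct sum of pairwise non-isomorphic indecomposables. -/
def IsBasic (U : C) : Prop :=
  ∃ (n : ℕ) (f : Fin n → C), (∀ i, Indec (f i)) ∧
    (∀ i j, Nonempty (f i ≅ f j) → i = j) ∧ Nonempty (U ≅ ⨁ f)

end Cat

/-- A support tilting object of `rep Q`: partial tilting, and tilting as a
`kQ/ann T`-module, i.e. tilting in the subcategory of all finite-dimensional
representations supported on the support of `T`. -/
def IsSupportTilting {k : Type} [Field k] {Q : FinQuiver} (T : RepC k Q) : Prop :=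
  IsPartialTilting T ∧ TiltingIn { M : RepC k Q | FinDim M ∧ SuppLE M T } T

section Comb

/-- The dimension vector of a representation. -/
def dimVec {k : Type} [Field k] {Q : FinQuiver} (M : RepC k Q) : Q.V → ℤ :=
  fun v => (Module.finrank k (M.obj ((Paths.of Q.V).obj v)) : ℤ)

/-- The Euler form of the quiver `Q`. -/
def euler (Q : FinQuiver) {R : Type} [CommRing R] (α β : Q.V → R) : R :=
  (∑ v : Q.V, α v * β v) - ∑ a : (Σ x : Q.V, Σ y : Q.V, x ⟶ y), α a.1 * β a.2.1

/-- The symmetrized Euler form of the quiver `Q`. -/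
def symEuler (Q : FinQuiver) {R : Type} [CommRing R] (α β : Q.V → R) : R :=
  euler Q α β + euler Q β α

/-- The reflection in the vector `v`: `s_v(w) = w - (v, w)·v`. -/
def reflV (Q : FinQuiver) (v : Q.V → ℤ) : (Q.V → ℤ) → (Q.V → ℤ) :=
  fun w => w - symEuler Q v w • v

/-- The composition (product, written from left to right) of a finite sequence of
linear transformations. -/
def comps (Q : FinQuiver) {m : ℕ} (g : Fin m → ((Q.V → ℤ) → (Q.V → ℤ))) :
    (Q.V → ℤ) → (Q.V → ℤ) :=
  (List.ofFn g).foldr (· ∘ ·) id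

open scoped Classical in
/-- The simple root at a vertex. -/
def simRoot (Q : FinQuiver) (v : Q.V) : Q.V → ℤ := fun w => if w = v then 1 else 0

/-- The simple reflection at a vertex. -/
def sref (Q : FinQuiver) (v : Q.V) : (Q.V → ℤ) → (Q.V → ℤ) := reflV Q (simRoot Q v)

/-- An enumeration of the vertices is compatible with the arrows of `Q` if sources
of arrows come before targets. -/
def OrdCompatible (Q : FinQuiver) (ord : Fin (Fintype.card Q.V) ≃ Q.V) : Prop :=
  ∀ (x y : Q.V), (x ⟶ y) → ord.symm x < ord.symm y

/-- The Coxeter element `cox(Q)`: the product of the simple reflections from left to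
right in an order compatible with the arrows of `Q`. -/
def coxeter (Q : FinQuiver) (ord : Fin (Fintype.card Q.V) ≃ Q.V) :
    (Q.V → ℤ) → (Q.V → ℤ) :=
  comps Q fun i => sref Q (ord i)

/-- The product of the simple reflections indexed by a word (a list of vertices). -/
def wordProd (Q : FinQuiver) (l : List Q.V) : (Q.V → ℤ) → (Q.V → ℤ) :=
  (l.map (sref Q)).foldr (· ∘ ·) id

/-- Membership in the Coxeter group `W` (realized faithfully on the root lattice). -/
def InW (Q : FinQuiver) (w : (Q.V → ℤ) → (Q.V → ℤ)) : Prop :=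
  ∃ l : List Q.V, w = wordProd Q l

/-- The reflections of `W`: the conjugates of the simple reflections. -/
def IsRefl (Q : FinQuiver) (t : (Q.V → ℤ) → (Q.V → ℤ)) : Prop :=
  ∃ (l : List Q.V) (i : Q.V), t = wordProd Q l ∘ sref Q i ∘ wordProd Q l.reverse

/-- The absolute length: the least length of an expression as a product of reflections. -/
def ellT (Q : FinQuiver) (w : (Q.V → ℤ) → (Q.V → ℤ)) : ℕ :=
  sInf { m | ∃ f : Fin m → ((Q.V → ℤ) → (Q.V → ℤ)), (∀ i, IsRefl Q (f i)) ∧ w = comps Q f }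

/-- The absolute order on `W`. -/
def absLe (Q : FinQuiver) : ((Q.V → ℤ) → (Q.V → ℤ)) → ((Q.V → ℤ) → (Q.V → ℤ)) → Prop :=
  Relation.ReflTransGen fun u v => ∃ t, IsRefl Q t ∧ v = u ∘ t ∧ ellT Q v = ellT Q u + 1

/-- The noncrossing partitions `NC_Q`: the interval `[e, cox(Q)]` in absolute order. -/
def NCSet (Q : FinQuiver) (ord : Fin (Fintype.card Q.V) ≃ Q.V) :
    Set ((Q.V → ℤ) → (Q.V → ℤ)) :=
  { w | InW Q w ∧ absLe Q w (coxeter Q ord) }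

/-- `Q` is of finite (Dynkin) type: the symmetrized Euler form is positive definite. -/
def FiniteType (Q : FinQuiver) : Prop :=
  ∀ α : Q.V → ℚ, α ≠ 0 → 0 < symEuler Q α α

/-- `Q` is of affine (extended Dynkin) type: the symmetrized Euler form is positive
semidefinite with nontrivial radical. -/
def AffineType (Q : FinQuiver) : Prop :=
  (∀ α : Q.V → ℚ, 0 ≤ symEuler Q α α) ∧ ∃ α : Q.V → ℚ, α ≠ 0 ∧ symEuler Q α α = 0

end Comb

section Statement9

variable {C : Type*} [Category C] [Abelian C]

/-- `P` is the direct sum of one representative of each isomorphism class of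
indecomposable objects of `T` that are Ext-projective but not split projective. -/
def NonSplitExtProjSum (T : Set C) (P : C) : Prop :=
  ∃ (n : ℕ) (f : Fin n → C),
    (∀ i, Indec (f i) ∧ ExtProjIn T (f i) ∧ ¬ SplitProjIn T (f i)) ∧
    (∀ i j, Nonempty (f i ≅ f j) → i = j) ∧
    (∀ X : C, Indec X → ExtProjIn T X → ¬ SplitProjIn T X → ∃ i, Nonempty (X ≅ f i)) ∧
    Nonempty (P ≅ ⨁ f)


lemma TC_iso {T : Set C} (hT : IsTorsionClass T) {X Y : C} (hX : X ∈ T) (i : Y ⟶ X) (r : X ⟶ Y)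
    (h : i ≫ r = 𝟙 Y) : Y ∈ T := hT.summand_mem X hX Y ⟨i, r, h⟩

lemma TC_image {T : Set C} (hT : IsTorsionClass T) {X Y : C} (hX : X ∈ T) (f : X ⟶ Y) :
    image f ∈ T := hT.quot_mem X hX _ (factorThruImage f) inferInstance

/-- lifting property -/
def LiftP (T : Set C) (A : C) : Prop :=
  ∀ (E D : C) (p : E ⟶ D), Epi p → kernel p ∈ T → ∀ g : A ⟶ D, ∃ l : A ⟶ E, l ≫ p = g

lemma kernel_pullback_mem {T : Set C} (hT : IsTorsionClass T) {A E D : C} (p : E ⟶ D)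
    (g : A ⟶ D) (h : kernel p ∈ T) : kernel (pullback.snd p g) ∈ T := by
  refine TC_iso hT h
    (kernel.lift p (kernel.ι (pullback.snd p g) ≫ pullback.fst p g) ?_)
    (kernel.lift _ (pullback.lift (kernel.ι p) 0 (by simp)) (pullback.lift_snd _ _ _)) ?_
  · rw [Category.assoc, pullback.condition, kernel.condition_assoc, zero_comp]
  · ext
    · have := pullback.lift_fst (f := p) (g := g) (kernel.ι p) 0 (by simp)
      simp [this]
    · have := pullback.lift_snd (f := p) (g := g) (kernel.ι p) 0 (by simp)
      simp [this]

lemma ses_kernel {E D : C} (p : E ⟶ D) [Epi p] :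
    (ShortComplex.mk (kernel.ι p) p (kernel.condition p)).ShortExact :=
  { exact := ShortComplex.exact_of_f_is_kernel _ (kernelIsKernel p)
    mono_f := by dsimp; infer_instance
    epi_g := by dsimp; infer_instance }

lemma extProj_lift {T : Set C} (hT : IsTorsionClass T) {A : C} (h : ∀ X ∈ T, Ext1Zero A X) :
    LiftP T A := by
  intro E D p hp hk g
  have hs := ses_kernel (pullback.snd p g)
  obtain ⟨r, hr⟩ := h _ (kernel_pullback_mem hT p g hk) _ _ _ _ hs
  let sp := ShortComplex.Splitting.ofExactOfRetraction _ hs.exact r hr hs.epi_g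
  refine ⟨sp.s ≫ pullback.fst p g, ?_⟩
  rw [Category.assoc, pullback.condition, ← Category.assoc]
  have := sp.s_g
  dsimp at this
  rw [this, Category.id_comp]

lemma lift_extProj {T : Set C} (hT : IsTorsionClass T) {A : C} (h : LiftP T A) :
    ∀ X ∈ T, Ext1Zero A X := by
  intro X hX E i p w hs
  have := hs.mono_f
  have := hs.epi_g
  dsimp at *
  have hk : kernel p ∈ T := by
    refine TC_iso hT hX (hs.exact.lift (kernel.ι p) (by simp)) (kernel.lift p i w) ?_
    ext
    have := hs.exact.lift_f (kernel.ι p) (by simp)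
    dsimp at this
    simp [this]
  obtain ⟨s, hs'⟩ := h E A p inferInstance hk (𝟙 A)
  let sp := ShortComplex.Splitting.ofExactOfSection _ hs.exact s hs' hs.mono_f
  exact ⟨sp.r, sp.f_r⟩

lemma lift_summand {T : Set C} {A B : C} (h : LiftP T A) (i : B ⟶ A) (r : A ⟶ B)
    (hir : i ≫ r = 𝟙 B) : LiftP T B := by
  intro E D p hp hk g
  obtain ⟨l, hl⟩ := h E D p hp hk (r ≫ g)
  exact ⟨i ≫ l, by rw [Category.assoc, hl, ← Category.assoc, hir, Category.id_comp]⟩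

lemma lift_sum {T : Set C} {n : ℕ} (f : Fin n → C) (h : ∀ i, LiftP T (f i)) : LiftP T (⨁ f) := by
  intro E D p hp hk g
  choose l hl using fun i => h i E D p hp hk (biproduct.ι f i ≫ g)
  refine ⟨biproduct.desc l, ?_⟩
  ext i
  simp [hl]

lemma dir1 {T : Set C} (hT : IsTorsionClass T) {P X : C} (hPT : P ∈ T) (hP : LiftP T P)
    (hfit : ∀ g : End P, IsIso g ∨ IsNilpotent g)
    (hns : ¬ SplitProjIn T P) (hX : X ∈ aSet T) : HomZero P X := by
  intro f
  by_contra hf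
  apply hns
  refine ⟨hPT, fun Y hY q hq => ?_⟩
  have hN := hX.2 P hPT f
  have hL := hX.2 Y hY (q ≫ f)
  have he : Epi (biprod.desc q (kernel.ι f)) := by
    have : Epi (biprod.inl ≫ biprod.desc q (kernel.ι f)) := by rw [biprod.inl_desc]; exact hq
    exact epi_of_epi biprod.inl _
  have hk : kernel (biprod.desc q (kernel.ι f)) ∈ T := by
    have key : (kernel.ι (biprod.desc q (kernel.ι f)) ≫ biprod.fst) ≫ q +
        (kernel.ι (biprod.desc q (kernel.ι f)) ≫ biprod.snd) ≫ kernel.ι f = 0 := by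
      have := kernel.condition (biprod.desc q (kernel.ι f))
      rw [biprod.desc_eq] at this
      rw [biprod.desc_eq]
      simpa using this
    refine TC_iso hT hL
      (kernel.lift _ (kernel.ι (biprod.desc q (kernel.ι f)) ≫ biprod.fst) ?_)
      (kernel.lift _ (biprod.lift (kernel.ι (q ≫ f)) (- kernel.lift f (kernel.ι (q ≫ f) ≫ q)
        (by simp))) (by simp)) ?_
    · have := congrArg (· ≫ f) key
      simpa using this
    · ext
      · simp
      · simp
        rw [eq_comm, ← sub_eq_zero, sub_neg_eq_add, add_comm]
        simpa using key
  obtain ⟨s, hs⟩ := hP _ _ _ he hk (𝟙 P)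
  rw [biprod.desc_eq] at hs
  have hs2 : (s ≫ biprod.fst) ≫ q + (s ≫ biprod.snd) ≫ kernel.ι f = 𝟙 P := by simpa using hs
  set g : End P := (s ≫ biprod.snd) ≫ kernel.ι f with hg
  rcases hfit g with h | h
  · exfalso
    apply hf
    rw [← cancel_epi g, comp_zero, hg, Category.assoc, kernel.condition, comp_zero]
  · have hu := h.isUnit_one_sub
    have : (1 - g : End P) = (s ≫ biprod.fst) ≫ q := by
      exact sub_eq_of_eq_add hs2.symm
    rw [this] at hu
    obtain ⟨u, hu⟩ := hu
    have h2 := u.mul_inv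
    rw [hu] at h2
    refine ⟨(u⁻¹ : (End P)ˣ).1 ≫ s ≫ biprod.fst, ?_⟩
    rw [Category.assoc]
    exact h2

/-- weakly initial -/
def WInit (T : Set C) {A T0 : C} (a : A ⟶ T0) : Prop :=
  T0 ∈ T ∧ ∀ Y ∈ T, ∀ y : A ⟶ Y, ∃ h : T0 ⟶ Y, a ≫ h = y

lemma coker_lift {T : Set C} (hT : IsTorsionClass T) {A T0 : C} (a : A ⟶ T0) (ha : WInit T a)
    (hmin : ∀ g : T0 ⟶ T0, a ≫ g = a → IsIso g) : LiftP T (cokernel a) := by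
  intro E D p hp hk g
  have hE : pullback p (cokernel.π a ≫ g) ∈ T :=
    hT.ext_mem _ (ses_kernel (pullback.snd p (cokernel.π a ≫ g)))
      (kernel_pullback_mem hT p _ hk) ha.1
  obtain ⟨h, hh⟩ := ha.2 _ hE (pullback.lift 0 a (by simp))
  have h1 : a ≫ (h ≫ pullback.snd _ _) = a := by rw [← Category.assoc, hh]; exact pullback.lift_snd _ _ _
  have h0 : a ≫ (h ≫ pullback.fst _ _) = 0 := by rw [← Category.assoc, hh]; exact pullback.lift_fst _ _ _
  have := hmin _ h1
  have h2 : a ≫ inv (h ≫ pullback.snd p (cokernel.π a ≫ g)) = a := by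
    rw [IsIso.comp_inv_eq, h1]
  refine ⟨cokernel.desc a (inv (h ≫ pullback.snd p (cokernel.π a ≫ g)) ≫ h ≫ pullback.fst _ _)
    ?_, ?_⟩
  · rw [← Category.assoc, h2, h0]
  · ext
    rw [cokernel.π_desc_assoc, Category.assoc, Category.assoc, pullback.condition,
      ← Category.assoc h, IsIso.inv_hom_id_assoc]

lemma coker_nonsplit {T : Set C} {A T0 S : C} (a : A ⟶ T0) (ha : WInit T a)
    (hmin : ∀ g : T0 ⟶ T0, a ≫ g = a → IsIso g) (i : S ⟶ cokernel a) (r : cokernel a ⟶ S)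
    (hir : i ≫ r = 𝟙 S) (hS : SplitProjIn T S) : IsZero S := by
  have : Epi r := by
    have : Epi (i ≫ r) := by rw [hir]; infer_instance
    exact epi_of_epi i r
  obtain ⟨s, hs⟩ := hS.2 T0 ha.1 (cokernel.π a ≫ r) inferInstance
  have := hmin (𝟙 T0 - (cokernel.π a ≫ r) ≫ s) (by simp)
  have h0 : (𝟙 T0 - (cokernel.π a ≫ r) ≫ s) ≫ (cokernel.π a ≫ r) = 0 := by
    rw [Preadditive.sub_comp, Category.assoc, hs]; simp
  rw [← comp_zero (X := T0) (f := 𝟙 T0 - (cokernel.π a ≫ r) ≫ s), cancel_epi] at h0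
  rw [IsZero.iff_id_eq_zero, ← hs, h0, comp_zero]

section Conc

variable {k : Type} [Field k] {Q : FinQuiver}

/-- total dimension -/
def tdim (M : RepC k Q) : ℕ := ∑ v : Q.V, Module.finrank k (M.obj ((Paths.of Q.V).obj v))

lemma app_surj {M N : RepC k Q} (p : M ⟶ N) [Epi p] (v : Paths Q.V) :
    Function.Surjective (p.app v) :=
  (ModuleCat.epi_iff_surjective _).1 (inferInstance : Epi (p.app v))

lemma app_inj {M N : RepC k Q} (p : M ⟶ N) [Mono p] (v : Paths Q.V) :
    Function.Injective (p.app v) :=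
  (ModuleCat.mono_iff_injective _).1 (inferInstance : Mono (p.app v))

lemma epi_of_surj {M N : RepC k Q} (p : M ⟶ N)
    (h : ∀ v, Function.Surjective (p.app v)) : Epi p := by
  have : ∀ v, Epi (p.app v) := fun v => (ModuleCat.epi_iff_surjective _).2 (h v)
  exact NatTrans.epi_of_epi_app p

lemma mono_of_inj {M N : RepC k Q} (p : M ⟶ N)
    (h : ∀ v, Function.Injective (p.app v)) : Mono p := by
  have : ∀ v, Mono (p.app v) := fun v => (ModuleCat.mono_iff_injective _).2 (h v)
  exact NatTrans.mono_of_mono_app p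

lemma finDim_epi {M N : RepC k Q} (p : M ⟶ N) [Epi p] (h : FinDim M) : FinDim N := fun v => by
  have := h v
  exact Module.Finite.of_surjective (p.app _).hom (app_surj p _)

lemma tdim_epi {M N : RepC k Q} (p : M ⟶ N) [Epi p] (h : FinDim M) : tdim N ≤ tdim M :=
  Finset.sum_le_sum fun v _ => by
    have := h v
    exact LinearMap.finrank_le_finrank_of_surjective (f := (p.app _).hom) (app_surj p _)

lemma iso_of_tdim {M N : RepC k Q} (p : M ⟶ N) [Epi p] (h : FinDim M) (he : tdim M ≤ tdim N) :
    IsIso p := by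
  have hle : ∀ v ∈ Finset.univ, Module.finrank k (N.obj ((Paths.of Q.V).obj v)) ≤
      Module.finrank k (M.obj ((Paths.of Q.V).obj v)) := fun v _ => by
    have := h v
    exact LinearMap.finrank_le_finrank_of_surjective (f := (p.app _).hom) (app_surj p _)
  have heq := (Finset.sum_eq_sum_iff_of_le hle).1 (le_antisymm (tdim_epi p h) he)
  have : Mono p := mono_of_inj p fun (v : Q.V) => by
    have h1 : FiniteDimensional k (M.obj ((Paths.of Q.V).obj v)) := h v
    have h2 : FiniteDimensional k (N.obj ((Paths.of Q.V).obj v)) := finDim_epi p h v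
    exact (LinearMap.injective_iff_surjective_of_finrank_eq_finrank (f := (p.app ((Paths.of Q.V).obj v)).hom)
      (heq v (Finset.mem_univ _)).symm).2 (app_surj p _)
  exact isIso_of_mono_of_epi p

lemma iso_of_mono_endo {M : RepC k Q} (g : M ⟶ M) [Mono g] (h : FinDim M) : IsIso g := by
  have : Epi g := epi_of_surj g fun (v : Q.V) => by
    have := h v
    exact LinearMap.surjective_of_injective (f := (g.app ((Paths.of Q.V).obj v)).hom) (app_inj g _)
  exact isIso_of_mono_of_epi g

lemma pow_app {P : RepC k Q} (g : End P) (n : ℕ) (v : Paths Q.V) :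
    (NatTrans.app (show P ⟶ P from g ^ n) v).hom =
      ((NatTrans.app (show P ⟶ P from g) v).hom : Module.End k (P.obj v)) ^ n := by
  induction n with
  | zero => rfl
  | succ n ih =>
    rw [pow_succ, pow_succ, ← ih]
    rfl

lemma fitting {P : RepC k Q} (hf : FinDim P) (hi : Indec P) (g : End P) :
    IsIso g ∨ IsNilpotent g := by
  have hev : ∀ᶠ n in Filter.atTop, ∀ v : Q.V,
      Disjoint (LinearMap.ker (((NatTrans.app (show P ⟶ P from g) ((Paths.of Q.V).obj v)).hom :
        Module.End k (P.obj ((Paths.of Q.V).obj v))) ^ n))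
        (LinearMap.range (((NatTrans.app (show P ⟶ P from g) ((Paths.of Q.V).obj v)).hom :
        Module.End k (P.obj ((Paths.of Q.V).obj v))) ^ n)) := by
    rw [Filter.eventually_all]
    intro v
    have : FiniteDimensional k (P.obj ((Paths.of Q.V).obj v)) := hf v
    exact Module.End.eventually_disjoint_ker_pow_range_pow _
  obtain ⟨n, hn, hn1⟩ := (hev.and (Filter.eventually_ge_atTop 1)).exists
  set G : P ⟶ P := g ^ n with hG
  have hGv : ∀ (v : Q.V) (x y : P.obj ((Paths.of Q.V).obj v)), x = G.app _ y → G.app _ x = 0 →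
      x = 0 := by
    intro v x y h1 h2
    have := hn v
    rw [← pow_app] at this
    exact Submodule.disjoint_def.1 this x h2 ⟨y, h1.symm⟩
  have hfac := image.fac G
  have hI : FinDim (image G) := finDim_epi (factorThruImage G) hf
  have hm : Mono (image.ι G ≫ factorThruImage G) := by
    apply mono_of_inj
    intro v
    rw [injective_iff_map_eq_zero]
    intro x hx
    obtain ⟨y, rfl⟩ := app_surj (factorThruImage G) v x
    have e1 : (image.ι G).app v ((factorThruImage G).app v y) = G.app v y := by
      conv_rhs => rw [← hfac]
      rfl
    have e2 : G.app v (G.app v y) = 0 := by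
      have : G.app v (G.app v y) = (image.ι G).app v ((factorThruImage G).app v (G.app v y)) := by
        exact (congrArg (fun φ : P ⟶ P => φ.app v (G.app v y)) hfac).symm
      rw [this, ← e1]
      have hx' : (factorThruImage G).app v ((image.ι G).app v ((factorThruImage G).app v y)) = 0 :=
        hx
      rw [hx', map_zero]
    have e3 := hGv v _ y rfl e2
    apply app_inj (image.ι G) v
    rw [e1, map_zero]
    exact e3
  have hiso := iso_of_mono_endo (image.ι G ≫ factorThruImage G) hI
  let r : P ⟶ image G := factorThruImage G ≫ inv (image.ι G ≫ factorThruImage G)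
  have hr : image.ι G ≫ r = 𝟙 _ := by
    rw [← Category.assoc, IsIso.hom_inv_id]
  have hes := ses_kernel r
  let sp := ShortComplex.Splitting.ofExactOfSection _ hes.exact (image.ι G) hr hes.mono_f
  rcases hi.2 _ _ sp.isoBinaryBiproduct with h0 | h0
  · left
    have hmr : Mono r := Preadditive.mono_of_kernel_zero (h0.eq_of_src _ _)
    have hri : IsIso r := isIso_of_mono_of_epi r
    have hi2 : IsIso (image.ι G) := by
      have : IsIso (image.ι G ≫ r) := by rw [hr]; infer_instance
      exact IsIso.of_isIso_comp_right _ r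
    have hfm : Mono (factorThruImage G) :=
      mono_of_mono (factorThruImage G) (inv (image.ι G ≫ factorThruImage G))
    have hGe : Mono G := by rw [← hfac]; exact mono_comp _ _
    have hg : Mono (show P ⟶ P from g) := by
      obtain ⟨m, rfl⟩ : ∃ m, n = m + 1 := ⟨n - 1, by omega⟩
      have : G = (show P ⟶ P from g) ≫ (show P ⟶ P from g ^ m) := by
        rw [hG, pow_succ]; rfl
      rw [this] at hGe
      exact mono_of_mono (show P ⟶ P from g) (show P ⟶ P from g ^ m)
    exact iso_of_mono_endo (show P ⟶ P from g) hf
  · right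
    refine ⟨n, ?_⟩
    change G = 0
    rw [← hfac, h0.eq_of_src (image.ι G) 0, comp_zero]

lemma hom_zero_of_parts {T : Set (RepC k Q)} {n : ℕ} (f : Fin n → RepC k Q) (X : RepC k Q)
    (hX : ∀ i, HomZero (f i) X)
    (hf : ∀ S : RepC k Q, Indec S → ExtProjIn T S → ¬ SplitProjIn T S → ∃ i, Nonempty (S ≅ f i))
    (W : RepC k Q) (hW : ∀ S, IsSummand S W → ExtProjIn T S ∧ (SplitProjIn T S → IsZero S)) :
    ∀ (d : ℕ) (Z : RepC k Q), tdim Z ≤ d → FinDim Z → IsSummand Z W → HomZero Z X := by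
  intro d
  induction d using Nat.strong_induction_on with
  | _ d ih =>
  intro Z hd hZf hZ
  by_cases h0 : IsZero Z
  · exact fun g => h0.eq_of_src _ _
  by_cases hi : Indec Z
  · obtain ⟨i, ⟨e⟩⟩ := hf Z hi (hW Z hZ).1 fun h => h0 ((hW Z hZ).2 h)
    intro g
    rw [← cancel_epi e.inv, comp_zero]
    exact hX i _
  · have : ∃ A B : RepC k Q, Nonempty (Z ≅ A ⊞ B) ∧ ¬ IsZero A ∧ ¬ IsZero B := by
      by_contra hc
      apply hi
      refine ⟨h0, fun A B e => ?_⟩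
      by_contra h
      push Not at h
      exact hc ⟨A, B, ⟨e⟩, h⟩
    obtain ⟨A, B, ⟨e⟩, hA, hB⟩ := this
    obtain ⟨i, r, hir⟩ := hZ
    have key : ∀ (D : RepC k Q) (a : D ⟶ Z) (b : Z ⟶ D), a ≫ b = 𝟙 D → ¬ IsIso b →
        HomZero D X := by
      intro D a b hab hb
      have : Epi b := by
        have : Epi (a ≫ b) := by rw [hab]; infer_instance
        exact epi_of_epi a b
      have hlt : tdim D < tdim Z := by
        by_contra h
        exact hb (iso_of_tdim b hZf (not_lt.1 h))
      refine ih (tdim D) (by omega) D le_rfl (finDim_epi b hZf) ⟨a ≫ i, r ≫ b, ?_⟩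
      rw [Category.assoc, ← Category.assoc i, hir, Category.id_comp, hab]
    have hA' : HomZero A X := by
      refine key A (biprod.inl ≫ e.inv) (e.hom ≫ biprod.fst) (by simp) fun h => hB ?_
      have : IsIso (biprod.fst : A ⊞ B ⟶ A) := IsIso.of_isIso_comp_left e.hom _
      rw [IsZero.iff_id_eq_zero]
      have h1 : (biprod.inr : B ⟶ A ⊞ B) = 0 := by
        rw [← cancel_mono (biprod.fst : A ⊞ B ⟶ A)]; simp
      rw [← biprod.inr_snd (X := A), h1, zero_comp]
    have hB' : HomZero B X := by
      refine key B (biprod.inr ≫ e.inv) (e.hom ≫ biprod.snd) (by simp) fun h => hA ?_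
      have : IsIso (biprod.snd : A ⊞ B ⟶ B) := IsIso.of_isIso_comp_left e.hom _
      rw [IsZero.iff_id_eq_zero]
      have h1 : (biprod.inl : A ⟶ A ⊞ B) = 0 := by
        rw [← cancel_mono (biprod.snd : A ⊞ B ⟶ B)]; simp
      rw [← biprod.inl_fst (Y := B), h1, zero_comp]
    intro g
    rw [← cancel_epi e.inv, comp_zero]
    apply biprod.hom_ext'
    · rw [comp_zero]; exact hA' _
    · rw [comp_zero]; exact hB' _

lemma exists_free (v : Paths Q.V) : ∃ (A : RepC k Q) (x : A.obj v),
    (∀ (M : RepC k Q) (m : M.obj v), ∃ h : A ⟶ M, h.app v x = m) ∧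
    (∀ (M : RepC k Q) (h h' : A ⟶ M), h.app v x = h'.app v x → h = h') := by
  refine ⟨coyoneda.obj (Opposite.op v) ⋙ ModuleCat.free k, ModuleCat.freeMk (𝟙 v), ?_, ?_⟩
  · intro M m
    refine ⟨{ app := fun w => ModuleCat.freeDesc (↾fun p : v ⟶ w => M.map p m)
              naturality := ?_ }, ?_⟩
    · intro w w' q
      apply ModuleCat.free_hom_ext
      intro p
      simp [ModuleCat.free_map_apply, ModuleCat.freeDesc_apply]
    · simp [ModuleCat.freeDesc_apply]
  · intro M h h' hh
    ext1; ext1 w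
    apply ModuleCat.free_hom_ext
    intro p
    have e : ∀ h : coyoneda.obj (Opposite.op v) ⋙ ModuleCat.free k ⟶ M,
        h.app w (ModuleCat.freeMk p) = M.map p (h.app v (ModuleCat.freeMk (𝟙 v))) := by
      intro h
      have := congrArg (fun φ => φ (ModuleCat.freeMk (𝟙 v))) (h.naturality p)
      simpa [ModuleCat.free_map_apply] using this
    rw [e, e, hh]

lemma sum_mem' {T : Set (RepC k Q)} (hT : IsTorsionClass T) {U : RepC k Q} (hU : U ∈ T) (n : ℕ) :
    (⨁ fun _ : Fin n => U) ∈ T := by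
  induction n with
  | zero =>
    refine TC_iso hT hT.zero_mem 0 0 ?_
    ext i
    exact i.elim0
  | succ n ih =>
    refine TC_iso hT (hT.sum_mem _ hU _ ih)
      (biprod.lift (biproduct.π _ 0) (biproduct.lift fun j => biproduct.π _ j.succ))
      (biprod.desc (biproduct.ι (fun _ : Fin (n+1) => U) 0)
        (biproduct.desc fun j => biproduct.ι (fun _ : Fin (n+1) => U) j.succ)) ?_
    rw [biprod.lift_desc, biproduct.lift_desc, ← biproduct.total, Fin.sum_univ_succ]

lemma exists_winit {T : Set (RepC k Q)} (hT : IsTorsionClass T) (hfd : ∀ X ∈ T, FinDim X)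
    (hfg : IsFinGen T) (v : Q.V) (A : RepC k Q) (x : A.obj ((Paths.of Q.V).obj v))
    (h1 : ∀ (M : RepC k Q) (m : M.obj ((Paths.of Q.V).obj v)), ∃ h : A ⟶ M, h.app _ x = m)
    (h2 : ∀ (M : RepC k Q) (h h' : A ⟶ M), h.app _ x = h'.app _ x → h = h') :
    ∃ (T0 : RepC k Q) (a : A ⟶ T0), WInit T a := by
  obtain ⟨U, hU, hgen⟩ := hfg
  have := hfd U hU v
  let b := Module.finBasis k (U.obj ((Paths.of Q.V).obj v))
  choose β hβ using fun i => h1 U (b i)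
  refine ⟨_, biproduct.lift β, sum_mem' hT hU _, fun Y hY y => ?_⟩
  have hlin : ∀ z : A ⟶ U, ∃ h : (⨁ fun _ => U) ⟶ U, biproduct.lift β ≫ h = z := by
    intro z
    refine ⟨∑ i, (b.repr (z.app _ x) i) • biproduct.π _ i, ?_⟩
    apply h2
    rw [Preadditive.comp_sum]
    simp only [Linear.comp_smul, biproduct.lift_π]
    have e : ∀ s : Finset (Fin (Module.finrank k (U.obj ((Paths.of Q.V).obj v)))),
        (∑ i ∈ s, (b.repr (z.app _ x) i) • β i).app ((Paths.of Q.V).obj v) x =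
        ∑ i ∈ s, (b.repr (z.app _ x) i) • b i := by
      intro s
      classical
      induction s using Finset.induction_on with
      | empty => simp
      | insert j s hj ih =>
        rw [Finset.sum_insert hj, Finset.sum_insert hj, ← ih, ← hβ j]
        simp
    rw [e, b.sum_repr]
  obtain ⟨B, ⟨n, f, hf, i, r, hir⟩, p, hp⟩ := hgen hY
  have hf' : f = fun _ => U := funext hf
  subst hf'
  have hr : Epi r := by
    have : Epi (i ≫ r) := by rw [hir]; infer_instance
    exact epi_of_epi i r
  obtain ⟨z, hz⟩ := app_surj (r ≫ p) ((Paths.of Q.V).obj v) (y.app _ x)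
  obtain ⟨ζ, hζ⟩ := h1 _ z
  have hζy : ζ ≫ r ≫ p = y := by
    apply h2
    rw [← hz, ← hζ]
    rfl
  choose h hh using fun j => hlin (ζ ≫ biproduct.π _ j)
  refine ⟨biproduct.lift h ≫ r ≫ p, ?_⟩
  rw [← Category.assoc]
  have : biproduct.lift β ≫ biproduct.lift h = ζ := by
    ext j
    simp [hh]
  rw [this, hζy]

lemma exists_min {T : Set (RepC k Q)} (hT : IsTorsionClass T) (hfd : ∀ X ∈ T, FinDim X)
    (A : RepC k Q) (hex : ∃ (T0 : RepC k Q) (a : A ⟶ T0), WInit T a) :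
    ∃ (T0 : RepC k Q) (a : A ⟶ T0), WInit T a ∧ ∀ g : T0 ⟶ T0, a ≫ g = a → IsIso g := by
  classical
  have hex' : ∃ d : ℕ, ∃ (T0 : RepC k Q) (a : A ⟶ T0), WInit T a ∧ tdim T0 = d := by
    obtain ⟨T0, a, h⟩ := hex
    exact ⟨_, T0, a, h, rfl⟩
  obtain ⟨T0, a, ha, hd⟩ := Nat.find_spec hex'
  refine ⟨T0, a, ha, fun g hg => ?_⟩
  have hw : WInit T (a ≫ factorThruImage g) := by
    refine ⟨TC_image hT ha.1 g, fun Y hY y => ?_⟩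
    obtain ⟨h, hh⟩ := ha.2 Y hY y
    refine ⟨image.ι g ≫ h, ?_⟩
    rw [Category.assoc, image.fac_assoc, ← Category.assoc, hg, hh]
  have hle := Nat.find_min' hex' ⟨_, _, hw, rfl⟩
  rw [← hd] at hle
  have := iso_of_tdim (factorThruImage g) (hfd _ ha.1) hle
  have hm : Mono g := by rw [← image.fac g]; infer_instance
  exact iso_of_mono_endo g (hfd _ ha.1)

lemma mem_of_generated {T : Set (RepC k Q)} (hT : IsTorsionClass T) (K : RepC k Q) (hK : FinDim K)
    (h : ∀ (v : Q.V) (y : K.obj ((Paths.of Q.V).obj v)), ∃ L ∈ T, ∃ (m : L ⟶ K)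
      (z : L.obj ((Paths.of Q.V).obj v)), m.app _ z = y) : K ∈ T := by
  classical
  have hex : ∃ d : ℕ, ∃ L ∈ T, ∃ m : L ⟶ K, tdim (cokernel m) = d :=
    ⟨_, 0, hT.zero_mem, 0, rfl⟩
  obtain ⟨L, hL, m, hm⟩ := Nat.find_spec hex
  refine hT.quot_mem L hL K m (Preadditive.epi_of_cokernel_zero ?_)
  suffices hz : ∀ v y, (cokernel.π m).app v y = 0 by
    ext v y
    exact hz v y
  intro v y
  obtain ⟨L', hL', m', z, hz⟩ := h v y
  have hle := Nat.find_min' hex ⟨L ⊞ L', hT.sum_mem _ hL _ hL', biprod.desc m m', rfl⟩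
  rw [← hm] at hle
  have hc := cokernel.condition (biprod.desc m m')
  have hcl : m ≫ cokernel.π (biprod.desc m m') = 0 := by
    have := congrArg (fun φ => biprod.inl ≫ φ) hc
    rwa [← Category.assoc, biprod.inl_desc, comp_zero] at this
  have hcr : m' ≫ cokernel.π (biprod.desc m m') = 0 := by
    have := congrArg (fun φ => biprod.inr ≫ φ) hc
    rwa [← Category.assoc, biprod.inr_desc, comp_zero] at this
  let q : cokernel m ⟶ cokernel (biprod.desc m m') := cokernel.desc m (cokernel.π _) hcl
  have hπ : cokernel.π m ≫ q = cokernel.π (biprod.desc m m') := cokernel.π_desc _ _ _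
  have hq : Epi q := by
    have : Epi (cokernel.π m ≫ q) := by rw [hπ]; infer_instance
    exact epi_of_epi (cokernel.π m) q
  have hiso : IsIso q := iso_of_tdim q (finDim_epi (cokernel.π m) hK) hle
  have h0 : m' ≫ cokernel.π m = 0 := by
    rw [← cancel_mono q, Category.assoc, hπ, zero_comp, hcr]
  rw [← hz]
  exact congrArg (fun φ : L' ⟶ cokernel m => φ.app v z) h0

end Conc

lemma dir2 {k : Type} [Field k] {Q : FinQuiver}
    (T : Set (RepC k Q)) (hT : IsTorsionClass T) (hfd : ∀ X ∈ T, FinDim X)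
    (hfg : IsFinGen T) {n : ℕ} (f : Fin n → RepC k Q)
    (hf : ∀ S : RepC k Q, Indec S → ExtProjIn T S → ¬ SplitProjIn T S → ∃ i, Nonempty (S ≅ f i))
    (X : RepC k Q) (hXT : X ∈ T) (hX : ∀ i, HomZero (f i) X) : X ∈ aSet T := by
  refine ⟨hXT, fun Y hY g => ?_⟩
  refine mem_of_generated hT _ ?_ ?_
  · intro v
    have : FiniteDimensional k (Y.obj ((Paths.of Q.V).obj v)) := hfd Y hY v
    exact Module.Finite.of_injective ((kernel.ι g).app _).hom (app_inj (kernel.ι g) _)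
  intro v y
  obtain ⟨A, x, h1, h2⟩ := exists_free (k := k) ((Paths.of Q.V).obj v)
  obtain ⟨T0, a, ha, hmin⟩ := exists_min hT hfd A (exists_winit hT hfd hfg v A x h1 h2)
  have hcT : cokernel a ∈ T := hT.quot_mem _ ha.1 _ (cokernel.π a) inferInstance
  have hc0 : HomZero (cokernel a) X := by
    refine hom_zero_of_parts (T := T) f X hX hf (cokernel a) ?_ _ _ le_rfl (hfd _ hcT)
      ⟨𝟙 _, 𝟙 _, Category.id_comp _⟩
    rintro S ⟨i, r, hir⟩
    exact ⟨⟨TC_iso hT hcT i r hir,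
      lift_extProj hT (lift_summand (coker_lift hT a ha hmin) i r hir)⟩,
      coker_nonsplit a ha hmin i r hir⟩
  obtain ⟨η, hη⟩ := h1 _ y
  obtain ⟨h, hh⟩ := ha.2 Y hY (η ≫ kernel.ι g)
  have h3 : a ≫ h ≫ g = 0 := by
    rw [← Category.assoc, hh, Category.assoc, kernel.condition, comp_zero]
  have h4 : h ≫ g = 0 := by
    rw [← cokernel.π_desc a (h ≫ g) h3, hc0 (cokernel.desc a (h ≫ g) h3), comp_zero]
  have h5 : a ≫ kernel.lift g h h4 = η := by
    rw [← cancel_mono (kernel.ι g), Category.assoc, kernel.lift_ι, hh]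
  refine ⟨T0, ha.1, kernel.lift g h h4, a.app _ x, ?_⟩
  rw [← hη, ← h5]
  rfl

/-- Let `T` be a finitely generated torsion class in `rep Q` and `P`
the direct sum of one representative of each isomorphism class of indecomposable
Ext-projective, non split projective, objects of `T`.  Then
`a(T) = {X ∈ T : Hom(P, X) = 0} = {X ∈ T : Hom(P, X) = 0 and Ext¹(P, X) = 0}`. -/
theorem statement9 (k : Type) [Field k] [IsAlgClosed k] (Q : FinQuiver)
    (T : Set (RepC k Q)) (hT : IsTorsionClass T) (hfd : ∀ X ∈ T, FinDim X)
    (hfg : IsFinGen T) (P : RepC k Q) (hP : NonSplitExtProjSum T P) :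
    aSet T = { X : RepC k Q | X ∈ T ∧ HomZero P X } ∧
    aSet T = { X : RepC k Q | X ∈ T ∧ HomZero P X ∧ Ext1Zero P X } := by
  obtain ⟨n, f, h1, -, h3, ⟨e⟩⟩ := hP
  have hL : LiftP T P := lift_summand (lift_sum f fun i => extProj_lift hT (h1 i).2.1.2)
    e.hom e.inv e.hom_inv_id
  have hext : ∀ X ∈ T, Ext1Zero P X := lift_extProj hT hL
  have main : ∀ X, X ∈ aSet T ↔ X ∈ T ∧ HomZero P X := by
    intro X
    constructor
    · intro hX
      refine ⟨hX.1, fun g => ?_⟩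
      rw [← cancel_epi e.inv, comp_zero]
      apply biproduct.hom_ext'
      intro j
      rw [comp_zero]
      exact dir1 hT (h1 j).2.1.1 (extProj_lift hT (h1 j).2.1.2)
        (fitting (hfd _ (h1 j).2.1.1) (h1 j).1) (h1 j).2.2 hX _
    · rintro ⟨hXT, hX⟩
      refine dir2 T hT hfd hfg f h3 X hXT fun i g => ?_
      have h : biproduct.ι f i ≫ e.inv ≫ e.hom ≫ biproduct.π f i ≫ g = g := by simp
      rw [← h, hX (e.hom ≫ biproduct.π f i ≫ g), comp_zero, comp_zero]
  constructor
  · ext X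
    exact main X
  · ext X
    rw [main]
    exact ⟨fun h => ⟨h.1, h.2, hext X h.1⟩, fun h => ⟨h.1, h.2.1⟩⟩

end Statement9
end NCPaper
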